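/- Let (M,l,r) be a bimodule over an anti-flexible algebra (A,·) and let (N,S) be a Nijenhuis structure on the A-bimodule M. Then for every natural number i ≥ 1, the pair (N^i, S^i) is again a Nijenhuis structure on the A-bimodule M. -/

import Mathlib

/-- The anti-flexible identity for a (bilinear) product. -/
def AntiFlexible {A : Type*} [AddCommGroup A] (mul : A → A → A) : Prop :=
  ∀ a b c : A, mul (mul a b) c - mul a (mul b c) = mul (mul c b) a - mul c (mul b a)

/-- The bimodule equations for `(M, l, r)` over `(A, mul)`. -/
def IsBimodule {K A M : Type*} [Field K] [AddCommGroup A] [Module K A]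
    [AddCommGroup M] [Module K M]
    (mul : A →ₗ[K] A →ₗ[K] A) (l r : A →ₗ[K] Module.End K M) : Prop :=
  (∀ a b : A, l (mul a b) - l a * l b = r a * r b - r (mul b a)) ∧
  (∀ a b : A, l a * r b - r b * l a = l b * r a - r a * l b)

/-- Nijenhuis operator on `(A, mul)`. -/
def IsNijenhuis {A : Type*} [AddCommGroup A] (mul : A → A → A) (N : A → A) : Prop :=
  ∀ a b : A, mul (N a) (N b) = N (mul (N a) b + mul a (N b) - N (mul a b))

/-- A Nijenhuis structure `(N, S)` on the `A`-bimodule `M`. -/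
def IsNijenhuisStructure {K A M : Type*} [Field K] [AddCommGroup A] [Module K A]
    [AddCommGroup M] [Module K M]
    (mul : A →ₗ[K] A →ₗ[K] A) (l r : A →ₗ[K] Module.End K M)
    (N : Module.End K A) (S : Module.End K M) : Prop :=
  IsNijenhuis (fun a b => mul a b) N ∧
  (∀ (a : A) (m : M),
    l (N a) (S m) = S (l (N a) m) + l a (S (S m)) - S (l a (S m))) ∧
  (∀ (a : A) (m : M),
    r (N a) (S m) = S (r (N a) m) + r a (S (S m)) - S (r a (S m)))

/-- If `[b, s] = [a, s] t` and `t` commutes with `s`, then `[b, s ^ k] = [a, s ^ k] t`. -/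
theorem commutator_pow_eq_commutator_pow_mul {R : Type*} [Ring R] {a b s t : R}
    (hst : Commute s t) (h : b * s - s * b = (a * s - s * a) * t) (k : ℕ) :
    b * s ^ k - s ^ k * b = (a * s ^ k - s ^ k * a) * t := by
  induction k with
  | zero => simp
  | succ k ih =>
    calc b * s ^ (k + 1) - s ^ (k + 1) * b
        = (b * s ^ k - s ^ k * b) * s + s ^ k * (b * s - s * b) := by
          rw [pow_succ]; noncomm_ring
      _ = (a * s ^ k - s ^ k * a) * (t * s) + s ^ k * (a * s - s * a) * t := by
          rw [ih, h]; noncomm_ring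
      _ = (a * s ^ (k + 1) - s ^ (k + 1) * a) * t := by
          rw [← hst.eq, pow_succ]; noncomm_ring

theorem action_pow_of_nijenhuis {K A M : Type*} [Field K] [AddCommGroup A] [Module K A]
    [AddCommGroup M] [Module K M] (f : A →ₗ[K] Module.End K M)
    (N : Module.End K A) (S : Module.End K M)
    (h : ∀ (a : A) (m : M),
      f (N a) (S m) = S (f (N a) m) + f a (S (S m)) - S (f a (S m)))
    (i : ℕ) (a : A) (m : M) :
    f ((N ^ i) a) ((S ^ i) m) =
      (S ^ i) (f ((N ^ i) a) m) + f a ((S ^ i) ((S ^ i) m)) - (S ^ i) (f a ((S ^ i) m)) := by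
  have h_one (a : A) : f (N a) * S - S * f (N a) = (f a * S - S * f a) * S := by
    ext m
    simp only [LinearMap.sub_apply, Module.End.mul_apply, h a m]
    abel
  have h_pow (j : ℕ) :
      f ((N ^ j) a) * S - S * f ((N ^ j) a) = (f a * S - S * f a) * S ^ j := by
    induction j with
    | zero => simp
    | succ j ih => rw [pow_succ', Module.End.mul_apply, h_one, ih, mul_assoc, ← pow_succ]
  have key := LinearMap.congr_fun
    (commutator_pow_eq_commutator_pow_mul (Commute.self_pow S i) (h_pow i) i) m
  simp only [LinearMap.sub_apply, Module.End.mul_apply] at key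
  rw [sub_eq_iff_eq_add] at key
  rw [key]
  abel

theorem IsNijenhuis.mul_pow_pow {K A : Type*} [Field K] [AddCommGroup A] [Module K A]
    {mul : A →ₗ[K] A →ₗ[K] A} {N : Module.End K A}
    (h : IsNijenhuis (fun a b => mul a b) N) (i j : ℕ) (a b : A) :
    mul ((N ^ i) a) ((N ^ j) b) =
      (N ^ j) (mul ((N ^ i) a) b) + (N ^ i) (mul a ((N ^ j) b))
        - (N ^ i) ((N ^ j) (mul a b)) := by
  have h_left (i : ℕ) (a b : A) : mul ((N ^ i) a) (N b) =
      N (mul ((N ^ i) a) b) + (N ^ i) (mul a (N b)) - (N ^ i) (N (mul a b)) := by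
    induction i with
    | zero => simp
    | succ i ih =>
      have key := h ((N ^ i) a) b
      simp only [ih, map_add, map_sub] at key
      simp only [pow_succ', Module.End.mul_apply, key]
      abel
  induction j with
  | zero => simp
  | succ j ih =>
    have h_comm (x : A) : N ((N ^ i) x) = (N ^ i) (N x) := by
      rw [← Module.End.mul_apply, ← Module.End.mul_apply, ← pow_succ', pow_succ]
    have key := h_left i a ((N ^ j) b)
    simp only [ih, map_add, map_sub, h_comm] at key
    simp only [pow_succ', Module.End.mul_apply, key]
    abel

/-- if `(N, S)` is a Nijenhuis structure on the `A`-bimodule `M`, then so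
is `(N^i, S^i)` for every `i ≥ 1`. -/
theorem nijenhuis_structure_powers {K A M : Type*} [Field K]
    [AddCommGroup A] [Module K A] [AddCommGroup M] [Module K M]
    (mul : A →ₗ[K] A →ₗ[K] A) (hA : AntiFlexible fun a b => mul a b)
    (l r : A →ₗ[K] Module.End K M) (hbim : IsBimodule mul l r)
    (N : Module.End K A) (S : Module.End K M)
    (hNS : IsNijenhuisStructure mul l r N S) :
    ∀ i : ℕ, 1 ≤ i → IsNijenhuisStructure mul l r (N ^ i) (S ^ i) := by
  intro i _
  obtain ⟨hN, hl, hr⟩ := hNS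
  refine ⟨fun a b => ?_, action_pow_of_nijenhuis l N S hl i, action_pow_of_nijenhuis r N S hr i⟩
  simp only [hN.mul_pow_pow i i a b, map_add, map_sub]
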